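/- arXiv:2012.06412 — 3 statements merged into one kernel-verified Lean document; each statement's English description precedes it below -/
import Mathlib

section
/- Let n be a positive integer and let w∈B_n be fully commutative. Then w^0 contains no two disjoint decreasing subsequences of length 3: there are no positions p_1<p_2<p_3 and q_1<q_2<q_3 in {1,…,2n} with {p_1,p_2,p_3}∩{q_1,q_2,q_3}=∅, w^0_{p_1}>w^0_{p_2}>w^0_{p_3} and w^0_{q_1}>w^0_{q_2}>w^0_{q_3}. -/
open scoped Classical

noncomputable section

namespace Paper

/-- Membership in the hyperoctahedral group `B_n`, realized inside `Equiv.Perm ℤ`: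
`w(-i) = -w(i)` and `w` fixes every integer of absolute value larger than `n`. -/
def InB (n : ℕ) (w : Equiv.Perm ℤ) : Prop :=
  (∀ i : ℤ, w (-i) = - w i) ∧ ∀ i : ℤ, (n : ℤ) < |i| → w i = i

/-- Window entry `w_i` with the convention `w_0 = 0`. -/
def went (w : Equiv.Perm ℤ) (i : ℕ) : ℤ := if i = 0 then 0 else w (i : ℤ)

/-- Stembridge's pattern criterion: `w ∈ B_n` is fully commutative iff there are no
indices `i<j` with `0 > w_i > w_j`, no `i<j<k` with `|w_i| > w_j > w_k`, and no
`i<j<k` with `-w_j > |w_i| > w_k`. -/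
def IsFC (n : ℕ) (w : Equiv.Perm ℤ) : Prop :=
  InB n w ∧
  (¬ ∃ i j : ℕ, 1 ≤ i ∧ i < j ∧ j ≤ n ∧ w (j : ℤ) < w (i : ℤ) ∧ w (i : ℤ) < 0) ∧
  (¬ ∃ i j k : ℕ, 1 ≤ i ∧ i < j ∧ j < k ∧ k ≤ n ∧
      w (j : ℤ) < |w (i : ℤ)| ∧ w (k : ℤ) < w (j : ℤ)) ∧
  (¬ ∃ i j k : ℕ, 1 ≤ i ∧ i < j ∧ j < k ∧ k ≤ n ∧
      |w (i : ℤ)| < - w (j : ℤ) ∧ w (k : ℤ) < |w (i : ℤ)|)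

/-- Membership in `S_n ⊆ B_n`: all window entries positive. -/
def InS (n : ℕ) (w : Equiv.Perm ℤ) : Prop :=
  InB n w ∧ ∀ i : ℕ, 1 ≤ i → i ≤ n → 0 < w (i : ℤ)

/-- 321-avoidance of the window. -/
def Avoids321 (n : ℕ) (w : Equiv.Perm ℤ) : Prop :=
  ¬ ∃ i j k : ℕ, 1 ≤ i ∧ i < j ∧ j < k ∧ k ≤ n ∧
    w (k : ℤ) < w (j : ℤ) ∧ w (j : ℤ) < w (i : ℤ)

/-- Type-B descent set `Des_B(w) = {0 ≤ i ≤ n-1 : w_i > w_{i+1}}`, convention `w_0 = 0`. -/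
def DesB (n : ℕ) (w : Equiv.Perm ℤ) : Finset ℕ :=
  (Finset.range n).filter fun i => went w (i+1) < went w i

/-- Type-A descent set `Des(w) = {1 ≤ i ≤ n-1 : w_i > w_{i+1}}`. -/
def DesA (n : ℕ) (w : Equiv.Perm ℤ) : Finset ℕ :=
  (Finset.Ico 1 n).filter fun i => went w (i+1) < went w i

/-- Last descent: `ldes(w) = max (Des_B(w) ∪ {0})`. -/
def ldes (n : ℕ) (w : Equiv.Perm ℤ) : ℕ := (DesB n w).sup id

/-- `Neg(w) = {1 ≤ i ≤ n : w_i < 0}`. -/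
def NegSet (n : ℕ) (w : Equiv.Perm ℤ) : Finset ℕ :=
  (Finset.Icc 1 n).filter fun i => w (i : ℤ) < 0

/-- Block number `bl(w) = 1 + #{1 ≤ i ≤ n-1 : max(w_1,…,w_i) < min(w_{i+1},…,w_n)}`. -/
def bl (n : ℕ) (w : Equiv.Perm ℤ) : ℕ :=
  1 + ((Finset.Ioo 0 n).filter fun i : ℕ =>
    ∀ j ∈ Finset.Icc 1 i, ∀ k ∈ Finset.Icc (i + 1) n, w ((j : ℕ) : ℤ) < w ((k : ℕ) : ℤ)).card

/-- Chow's type-B fundamental quasi-symmetric function `F^B_J` in variables `x_0,x_1,…`: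
the sum of `x_{i_1} ⋯ x_{i_n}` over `0 ≤ i_1 ≤ ⋯ ≤ i_n` with `i_j < i_{j+1}` for `j ∈ J`,
with the convention `i_0 = 0`. A sequence is encoded by `f : ℕ → ℕ` with `f a = i_a`
for `1 ≤ a ≤ n`, normalized by `f 0 = 0` and `f a = 0` for `a > n`. -/
def FB (R : Type) [CommRing R] (n : ℕ) (J : Finset ℕ) : MvPowerSeries ℕ R :=
  fun m => (Nat.card {f : ℕ → ℕ //
    f 0 = 0 ∧ (∀ a, n < a → f a = 0) ∧
    (∀ a b, a ≤ b → b ≤ n → f a ≤ f b) ∧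
    (∀ j ∈ J, f j < f (j + 1)) ∧
    ∀ v : ℕ, m v = ((Finset.Icc 1 n).filter fun a => f a = v).card} : R)

/-- Gessel's fundamental quasi-symmetric function `F_J` in variables `x_1,x_2,…`. -/
def FA (R : Type) [CommRing R] (n : ℕ) (J : Finset ℕ) : MvPowerSeries ℕ R :=
  fun m => (Nat.card {f : ℕ → ℕ //
    f 0 = 0 ∧ (∀ a, n < a → f a = 0) ∧
    (∀ a, 1 ≤ a → a ≤ n → 1 ≤ f a) ∧
    (∀ a b, 1 ≤ a → a ≤ b → b ≤ n → f a ≤ f b) ∧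
    (∀ j ∈ J, f j < f (j + 1)) ∧
    ∀ v : ℕ, m v = ((Finset.Icc 1 n).filter fun a => f a = v).card} : R)

/-- Complete homogeneous symmetric function `h_m` in the variables `x_s, x_{s+1}, …`. -/
def hSeries (R : Type) [CommRing R] (s m : ℕ) : MvPowerSeries ℕ R :=
  fun μ => if (μ.sum fun _ v => v) = m ∧ ∀ a < s, μ a = 0 then 1 else 0

/-- Number of semistandard Young tableaux of shape `lam` (row lengths `lam 0 ≥ lam 1 ≥ …`),
with all entries `≥ s`, rows weakly increasing, columns strictly increasing,
and content `μ` (the value `v` occurs `μ v` times). Tableaux are normalized to be `0`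
outside the cells of the diagram. -/
def schurCoeff (s : ℕ) (lam : ℕ → ℕ) (μ : ℕ → ℕ) : ℕ :=
  Nat.card {T : ℕ → ℕ → ℕ //
    (∀ i j, j + 1 < lam i → T i j ≤ T i (j + 1)) ∧
    (∀ i j, j < lam (i + 1) → T i j < T (i + 1) j) ∧
    (∀ i j, j < lam i → s ≤ T i j) ∧
    (∀ i j, ¬ j < lam i → T i j = 0) ∧
    ∀ v : ℕ, μ v = Nat.card {p : ℕ × ℕ // p.2 < lam p.1 ∧ T p.1 p.2 = v}}

/-- The Schur function `s_lam` in the variables `x_s, x_{s+1}, …`. -/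
def schurS (R : Type) [CommRing R] (s : ℕ) (lam : ℕ → ℕ) : MvPowerSeries ℕ R :=
  fun m => (schurCoeff s lam (fun v => m v) : R)

/-- The two-row shape `(a, b)` as a row-length function. -/
def twoRow (a b : ℕ) : ℕ → ℕ := fun i => if i = 0 then a else if i = 1 then b else 0

/-- Row-length function of a partition of `k`. -/
def partFun {k : ℕ} (p : Nat.Partition k) : ℕ → ℕ :=
  fun i => ((p.parts.sort (· ≤ ·)).reverse).getD i 0

/-- Conjugate of a row-length function. -/
def conjFun (lam : ℕ → ℕ) : ℕ → ℕ := fun j => Nat.card {i : ℕ // j < lam i}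

/-- Descent set of the standard Young tableau of skew shape `(n,k)/(k)` (resp. of the
bi-tableau of bi-shape `((k),(n-k))`) encoded by the set `S ⊆ {1,…,n}` of entries of the
length-`k` bottom row: `{1 ≤ i ≤ n-1 : i ∉ S, i+1 ∈ S}`. -/
def DesSet (n : ℕ) (S : Finset ℕ) : Finset ℕ :=
  (Finset.Ico 1 n).filter fun i => i ∉ S ∧ i + 1 ∈ S

/-- Last descent of the tableau encoded by `S`. -/
def ldesSet (n : ℕ) (S : Finset ℕ) : ℕ := (DesSet n S).sup id

/-- Type-B descent set of the bi-tableau encoded by `S`: add `0` when `1 ∈ S`. -/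
def DesBSet (n : ℕ) (S : Finset ℕ) : Finset ℕ :=
  if 1 ∈ S then insert 0 (DesSet n S) else DesSet n S

/-- `b_{n,k,j}`: the number of standard Young tableaux of skew shape `(n,k)/(k)`
(encoded by `k`-subsets `S ⊆ {1,…,n}`) with `ldes = n - j`. -/
def bCoeff (n k j : ℕ) : ℕ :=
  ((Finset.Icc 1 n).powerset.filter fun S => S.card = k ∧ ldesSet n S = n - j).card

/-- `a_{n,k,j}`: the number of standard Young tableaux of shape `(n-k,k)` (encoded by
`k`-subsets `S ⊆ {1,…,n}` of second-row entries satisfying the ballot condition)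
with `ldes = n - j`. -/
def aCoeff (n k j : ℕ) : ℕ :=
  ((Finset.Icc 1 n).powerset.filter fun S => S.card = k ∧
    (∀ i ∈ Finset.Icc 1 n, 2 * (S.filter (· ≤ i)).card ≤ i) ∧ ldesSet n S = n - j).card

/-- `e_{n,m,J}`: number of `m`-subsets `S ⊆ {1,…,n}` with `Des_B(S) = J`. -/
def eCoeff (n m : ℕ) (J : Finset ℕ) : ℕ :=
  ((Finset.Icc 1 n).powerset.filter fun S => S.card = m ∧ DesBSet n S = J).card

/-- `d_{n,m,j}`: number of `m`-subsets `S ⊆ {1,…,n}` with `ldes(S) = n - j`. -/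
def dCoeff (n m j : ℕ) : ℕ :=
  ((Finset.Icc 1 n).powerset.filter fun S => S.card = m ∧ ldesSet n S = n - j).card

/-- The palindromic representation `w^0 = [-w_n, …, -w_1, w_1, …, w_n]`,
as a function of the position `p ∈ {1,…,2n}`. -/
def wzero (n : ℕ) (w : Equiv.Perm ℤ) : ℕ → ℤ :=
  fun p => if p ≤ n then - w ((n : ℤ) + 1 - (p : ℤ)) else w ((p : ℤ) - (n : ℤ))

/-- Greene invariant: the maximal total size of a union of `j` increasing subsequences
of `w^0` (a set of positions is such a union iff it admits a coloring by `j` colors with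
each color class increasing). By Greene's theorem this equals `λ_1 + ⋯ + λ_j` for the
RSK shape `λ(w^0)`. -/
def greene (n : ℕ) (w : Equiv.Perm ℤ) (j : ℕ) : ℕ :=
  ((Finset.Icc 1 (2 * n)).powerset.filter fun P =>
    ∃ c : ℕ → Fin j, ∀ p ∈ P, ∀ q ∈ P, p < q → c p = c q →
      wzero n w p < wzero n w q).sup Finset.card

/-- First valley `v(π)`. -/
def firstValley (n : ℕ) (π : Equiv.Perm ℤ) : ℕ :=
  if h : ((DesA n π⁻¹).erase 1).Nonempty then ((DesA n π⁻¹).erase 1).min' h else n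

/-- Order key for the order `-1 <r -2 <r ⋯ <r -n <r 1 <r ⋯ <r n`. -/
def rkey (n : ℕ) (a : ℤ) : ℤ := if a < 0 then -a else a + n

/-- The r-descent set `rDes(w) = {1 ≤ i ≤ n-1 : w_i >r w_{i+1}}`. -/
def rDes (n : ℕ) (w : Equiv.Perm ℤ) : Finset ℕ :=
  (Finset.Ico 1 n).filter fun i : ℕ =>
    rkey n (w (((i : ℕ) + 1 : ℕ) : ℤ)) < rkey n (w ((i : ℕ) : ℤ))

/-- Poirier's type-B quasi-symmetric function `F^P_w(X,Y)`, a power series in the two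
alphabets `x_1,x_2,…` (indexed by `Sum.inl`) and `y_1,y_2,…` (indexed by `Sum.inr`). -/
def FP (n : ℕ) (w : Equiv.Perm ℤ) : MvPowerSeries (ℕ ⊕ ℕ) ℤ :=
  fun m => (Nat.card {f : ℕ → ℕ //
    f 0 = 0 ∧ (∀ a, n < a → f a = 0) ∧
    (∀ a, 1 ≤ a → a ≤ n → 1 ≤ f a) ∧
    (∀ a b, 1 ≤ a → a ≤ b → b ≤ n → f a ≤ f b) ∧
    (∀ j ∈ rDes n w, f j < f (j + 1)) ∧
    (∀ v : ℕ, m (Sum.inl v) =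
      ((Finset.Icc 1 n).filter fun a => f a = v ∧ 0 < w ((a : ℕ) : ℤ)).card) ∧
    ∀ v : ℕ, m (Sum.inr v) =
      ((Finset.Icc 1 n).filter fun a => f a = v ∧ w ((a : ℕ) : ℤ) < 0).card} : ℤ)

/-- The Schur function `s_lam(X)` in the first alphabet `x_1,x_2,…`. -/
def schurX (lam : ℕ → ℕ) : MvPowerSeries (ℕ ⊕ ℕ) ℤ :=
  fun m => if ∀ v, m (Sum.inr v) = 0 then
    (schurCoeff 1 lam fun v => m (Sum.inl v) : ℤ) else 0

/-- The Schur function `s_lam(Y)` in the second alphabet `y_1,y_2,…`. -/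
def schurY (lam : ℕ → ℕ) : MvPowerSeries (ℕ ⊕ ℕ) ℤ :=
  fun m => if ∀ v, m (Sum.inl v) = 0 then
    (schurCoeff 1 lam fun v => m (Sum.inr v) : ℤ) else 0

/-- Chow type-B Schur-positivity: a nonnegative combination of the products
`s_{λ⁻}(x_1,x_2,…) ⋅ s_{λ⁺}(x_0,x_1,…)` over pairs of partitions of total size `n`. -/
def ChowPos (n : ℕ) (F : MvPowerSeries ℕ ℤ) : Prop :=
  ∃ c : (Σ k : Fin (n + 1), Nat.Partition (k : ℕ) × Nat.Partition (n - (k : ℕ))) → ℕ,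
    F = ∑ p : (Σ k : Fin (n + 1), Nat.Partition (k : ℕ) × Nat.Partition (n - (k : ℕ))),
      (c p : ℤ) • (schurS ℤ 1 (partFun p.2.1) * schurS ℤ 0 (partFun p.2.2))

/-- Integer-indexed form of the conditions defining `IsFC`. -/
theorem IsFC.int_form {n : ℕ} {w : Equiv.Perm ℤ} (hw : IsFC n w) :
    (∀ i j : ℤ, 0 < i → i < j → j ≤ n → w j < w i → 0 ≤ w i) ∧
    (∀ i j k : ℤ, 0 < i → i < j → j < k → k ≤ n → w j < |w i| → w j ≤ w k) ∧
    (∀ i j k : ℤ, 0 < i → i < j → j < k → k ≤ n → |w i| < - w j → |w i| ≤ w k) := by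
  obtain ⟨-, hA, hB, hC⟩ := hw
  refine ⟨fun i j hi hij hj h => ?_, fun i j k hi hij hjk hk h => ?_,
    fun i j k hi hij hjk hk h => ?_⟩
  · lift i to ℕ using hi.le
    lift j to ℕ using by omega
    by_contra! h'
    exact hA ⟨i, j, by omega, by omega, by omega, h, h'⟩
  · lift i to ℕ using hi.le
    lift j to ℕ using by omega
    lift k to ℕ using by omega
    by_contra! h'
    exact hB ⟨i, j, k, by omega, by omega, by omega, by omega, h, h'⟩
  · lift i to ℕ using hi.le
    lift j to ℕ using by omega
    lift k to ℕ using by omega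
    by_contra! h'
    exact hC ⟨i, j, k, by omega, by omega, by omega, by omega, h, h'⟩

/-- If `-w_i > w_b > w_c` with `0 < b < c`, then `i = c` and `|w_b| < -w_c`. -/
theorem IsFC.eq_of_lt_of_lt {n : ℕ} {w : Equiv.Perm ℤ} (hw : IsFC n w) {i b c : ℤ}
    (hi : 0 < i) (hin : i ≤ n) (hb : 0 < b) (hbc : b < c) (hc : c ≤ n)
    (h₁ : w b < - w i) (h₂ : w c < w b) : i = c ∧ |w b| < - w c := by
  obtain ⟨hA, hB, hC⟩ := hw.int_form
  have hb0 := hA b c hb hbc hc h₂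
  have habs : |w b| = w b := abs_of_nonneg hb0
  have hic : i = c := by
    rcases lt_trichotomy i b with h | h | h
    · have := hB i b c hi h hbc hc (h₁.trans_le (neg_le_abs _))
      omega
    · subst h
      omega
    rcases lt_trichotomy i c with h' | h' | h'
    · have := hC b i c hb h h' hc (by omega)
      omega
    · exact h'
    · have h₃ := hB b c i hb hbc h' hin (by omega)
      have h₄ : w c ≠ w i := fun e => h'.ne (w.injective e)
      have := hC b c i hb hbc h' hin (by omega)
      omega
  subst hic
  exact ⟨rfl, by omega⟩

/-- Every decreasing triple of values of a fully commutative `w` sits at positions `-c, b, c`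
with `c > 0`, and `|w_d| < -w_c` for some `0 < d < c`. -/
theorem IsFC.decreasing_triple {n : ℕ} {w : Equiv.Perm ℤ} (hw : IsFC n w) {a b c : ℤ}
    (ha : -(n : ℤ) ≤ a) (hab : a < b) (hbc : b < c) (hc : c ≤ n)
    (ha0 : a ≠ 0) (hb0 : b ≠ 0) (hc0 : c ≠ 0) (h₁ : w b < w a) (h₂ : w c < w b) :
    a = -c ∧ 0 < c ∧ ∃ d, 0 < d ∧ d < c ∧ |w d| < - w c := by
  have hneg := hw.1.1
  obtain ⟨-, hB, -⟩ := hw.int_form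
  have hna := hneg a
  have hnb := hneg b
  have hnc := hneg c
  rcases lt_or_gt_of_ne hb0 with hb | hb
  · rcases lt_or_gt_of_ne hc0 with hc' | hc'
    · have := hB (-c) (-b) (-a) (by omega) (by omega) (by omega) (by omega)
        (lt_of_lt_of_le (by omega) (le_abs_self _))
      omega
    · obtain ⟨h, h'⟩ := hw.eq_of_lt_of_lt (i := c) (b := -b) (c := -a) hc' hc
        (by omega) (by omega) (by omega) (by omega) (by omega)
      exact ⟨by omega, hc', -b, by omega, by omega, h ▸ h'⟩
  · rcases lt_or_gt_of_ne ha0 with ha' | ha'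
    · obtain ⟨h, h'⟩ := hw.eq_of_lt_of_lt (i := -a) (b := b) (c := c) (by omega) (by omega)
        hb hbc hc (by omega) h₂
      exact ⟨by omega, by omega, b, hb, hbc, h'⟩
    · have := hB a b c ha' hab hbc hc (h₁.trans_le (le_abs_self _))
      omega

/-- A negative entry `w_c` exceeding some earlier entry in absolute value is the last negative
entry of the window. -/
theorem IsFC.le_of_abs_lt {n : ℕ} {w : Equiv.Perm ℤ} (hw : IsFC n w) {c c' d : ℤ}
    (hd : 0 < d) (hdc : d < c) (h : |w d| < - w c) (hc' : c' ≤ n) (hneg : w c' < 0) :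
    c' ≤ c := by
  by_contra! hlt
  have := hw.int_form.2.2 d c c' hd hdc hlt hc' h
  have := abs_nonneg (w d)
  omega

/-- The signed index in `{-n, …, -1, 1, …, n}` of a position of the palindromic representation. -/
def signedIndex (n p : ℕ) : ℤ := if p ≤ n then (p : ℤ) - n - 1 else (p : ℤ) - n

theorem wzero_eq_signedIndex {n : ℕ} {w : Equiv.Perm ℤ} (hw : InB n w) (p : ℕ) :
    wzero n w p = w (signedIndex n p) := by
  unfold wzero signedIndex
  split_ifs
  · rw [← hw.1]
    congr 1
    ring
  · rfl

theorem signedIndex_lt {n p q : ℕ} (h : p < q) : signedIndex n p < signedIndex n q := by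
  unfold signedIndex
  split_ifs <;> omega

theorem signedIndex_ne_zero (n p : ℕ) : signedIndex n p ≠ 0 := by
  unfold signedIndex
  split_ifs <;> omega

theorem neg_le_signedIndex {n p : ℕ} (h : 1 ≤ p) : -(n : ℤ) ≤ signedIndex n p := by
  unfold signedIndex
  split_ifs <;> omega

theorem signedIndex_le {n p : ℕ} (h : p ≤ 2 * n) : signedIndex n p ≤ n := by
  unfold signedIndex
  split_ifs <;> omega

theorem signedIndex_injective (n : ℕ) : Function.Injective (signedIndex n) :=
  StrictMono.injective fun _ _ => signedIndex_lt

theorem no_two_disjoint_decreasing_three (n : ℕ) (hn : 0 < n) (w : Equiv.Perm ℤ)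
    (hw : IsFC n w) :
    ¬ ∃ p₁ p₂ p₃ q₁ q₂ q₃ : ℕ,
      1 ≤ p₁ ∧ p₁ < p₂ ∧ p₂ < p₃ ∧ p₃ ≤ 2 * n ∧
      1 ≤ q₁ ∧ q₁ < q₂ ∧ q₂ < q₃ ∧ q₃ ≤ 2 * n ∧
      ({p₁, p₂, p₃} : Finset ℕ) ∩ {q₁, q₂, q₃} = ∅ ∧
      wzero n w p₂ < wzero n w p₁ ∧ wzero n w p₃ < wzero n w p₂ ∧
      wzero n w q₂ < wzero n w q₁ ∧ wzero n w q₃ < wzero n w q₂ := by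
  rintro ⟨p₁, p₂, p₃, q₁, q₂, q₃, hp₁, hp₁₂, hp₂₃, hp₃, hq₁, hq₁₂, hq₂₃, hq₃, hdisj,
    hp, hp', hq, hq'⟩
  simp only [wzero_eq_signedIndex hw.1] at hp hp' hq hq'
  obtain ⟨-, -, d, hd, hdc, hdw⟩ := hw.decreasing_triple (neg_le_signedIndex hp₁)
    (signedIndex_lt hp₁₂) (signedIndex_lt hp₂₃) (signedIndex_le hp₃) (signedIndex_ne_zero _ _)
    (signedIndex_ne_zero _ _) (signedIndex_ne_zero _ _) hp hp'
  obtain ⟨-, -, e, he, hec, hew⟩ := hw.decreasing_triple (neg_le_signedIndex hq₁)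
    (signedIndex_lt hq₁₂) (signedIndex_lt hq₂₃) (signedIndex_le hq₃) (signedIndex_ne_zero _ _)
    (signedIndex_ne_zero _ _) (signedIndex_ne_zero _ _) hq hq'
  have hd0 := abs_nonneg (w d)
  have he0 := abs_nonneg (w e)
  have heq : p₃ = q₃ := signedIndex_injective n <| le_antisymm
    (hw.le_of_abs_lt he hec hew (signedIndex_le hp₃) (by omega))
    (hw.le_of_abs_lt hd hdc hdw (signedIndex_le hq₃) (by omega))
  have hmem : p₃ ∈ ({p₁, p₂, p₃} : Finset ℕ) ∩ {q₁, q₂, q₃} := by simp [heq]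
  simp [hdisj] at hmem

end Paper
end
end

section
/- Let n be a positive integer, let μ∈B_n satisfy μ_1<μ_2<⋯<μ_n, and let π,σ∈S_n⊆B_n with Des(π)=Des(σ). Then Des_B(π∘μ^{-1}) = Des_B(σ∘μ^{-1}); in other words, the type-B descent set of π∘μ^{-1} depends only on μ and on the descent set of π. -/
open scoped Classical

noncomputable section

namespace Paper

theorem InB.map_zero {n : ℕ} {w : Equiv.Perm ℤ} (hw : InB n w) : w 0 = 0 := by
  have h := hw.1 0
  rw [neg_zero] at h
  omega

theorem InB.inv_abs_le {n : ℕ} {w : Equiv.Perm ℤ} (hw : InB n w) {i : ℤ} (hi : |i| ≤ n) :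
    |w⁻¹ i| ≤ n := by
  by_contra! h
  have h' := hw.2 _ h
  rw [Equiv.Perm.inv_def, Equiv.apply_symm_apply, ← Equiv.Perm.inv_def] at h'
  rw [← h'] at h
  omega

theorem InB.inv_ne_zero {n : ℕ} {w : Equiv.Perm ℤ} (hw : InB n w) {i : ℤ} (hi : i ≠ 0) :
    w⁻¹ i ≠ 0 := by
  intro h
  rw [Equiv.Perm.inv_eq_iff_eq, hw.map_zero] at h
  exact hi h

theorem InS.map_pos {n : ℕ} {w : Equiv.Perm ℤ} (hw : InS n w) {a : ℤ} (ha : 0 < a)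
    (han : |a| ≤ n) : 0 < w a := by
  rw [abs_le] at han
  lift a to ℕ using ha.le
  exact hw.2 a (by omega) (by omega)

theorem InS.map_neg {n : ℕ} {w : Equiv.Perm ℤ} (hw : InS n w) {a : ℤ} (ha : a < 0)
    (han : |a| ≤ n) : w a < 0 := by
  have h := hw.map_pos (a := -a) (by omega) (by rwa [abs_neg])
  rw [hw.1.1] at h
  omega

/-- An increasing signed permutation takes consecutive values at consecutive positions. -/
theorem eq_succ_of_map_eq_succ {n : ℕ} {w : Equiv.Perm ℤ}
    (hinc : ∀ i j : ℕ, 1 ≤ i → i < j → j ≤ n → w (i : ℤ) < w (j : ℤ)) {a b : ℕ}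
    (ha : 1 ≤ a) (han : a ≤ n) (hb : 1 ≤ b) (hbn : b ≤ n)
    (h : w (b : ℤ) = w (a : ℤ) + 1) : b = a + 1 := by
  rcases lt_trichotomy b (a + 1) with hlt | heq | hgt
  · rcases Nat.lt_succ_iff_lt_or_eq.mp hlt with hlt | rfl
    · have := hinc b a hb hlt han
      omega
    · omega
  · exact heq
  · have h₁ := hinc a (a + 1) ha (by omega) (by omega)
    have h₂ := hinc (a + 1) b (by omega) hgt hbn
    omega

theorem map_succ_lt_iff_of_desA_eq {n : ℕ} {π σ : Equiv.Perm ℤ} (h : DesA n π = DesA n σ)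
    {a : ℕ} (ha : 1 ≤ a) (han : a + 1 ≤ n) :
    π ((a + 1 : ℕ) : ℤ) < π (a : ℤ) ↔ σ ((a + 1 : ℕ) : ℤ) < σ (a : ℤ) := by
  have hmem := Finset.ext_iff.mp h a
  have ha0 : a ≠ 0 := by omega
  have han' : a < n := by omega
  simpa [DesA, went, ha, han', ha0] using hmem

theorem desB_depends_only_on_des (n : ℕ) (hn : 0 < n) (μ π σ : Equiv.Perm ℤ)
    (hμ : InB n μ)
    (hμinc : ∀ i j : ℕ, 1 ≤ i → i < j → j ≤ n → μ (i : ℤ) < μ (j : ℤ))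
    (hπ : InS n π) (hσ : InS n σ) (hdes : DesA n π = DesA n σ) :
    DesB n (π * μ⁻¹) = DesB n (σ * μ⁻¹) := by
  refine Finset.filter_congr fun i hi => ?_
  rw [Finset.mem_range] at hi
  have hb0 : μ⁻¹ ((i + 1 : ℕ) : ℤ) ≠ 0 := hμ.inv_ne_zero (by omega)
  have hbn : |μ⁻¹ ((i + 1 : ℕ) : ℤ)| ≤ n := hμ.inv_abs_le (by rw [abs_le]; omega)
  have hμb : μ (μ⁻¹ ((i + 1 : ℕ) : ℤ)) = ((i + 1 : ℕ) : ℤ) := μ.apply_symm_apply _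
  simp only [went, Nat.add_eq_zero_iff, one_ne_zero, and_false, if_false, Equiv.Perm.mul_apply]
  generalize μ⁻¹ ((i + 1 : ℕ) : ℤ) = b at *
  by_cases hi0 : i = 0
  · simp only [hi0, if_true]
    rcases lt_or_gt_of_ne hb0 with hb | hb
    · exact iff_of_true (hπ.map_neg hb hbn) (hσ.map_neg hb hbn)
    · exact iff_of_false (hπ.map_pos hb hbn).not_gt (hσ.map_pos hb hbn).not_gt
  have ha0 : μ⁻¹ (i : ℤ) ≠ 0 := hμ.inv_ne_zero (by omega)
  have han : |μ⁻¹ (i : ℤ)| ≤ n := hμ.inv_abs_le (by rw [abs_le]; omega)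
  have hμa : μ (μ⁻¹ (i : ℤ)) = (i : ℤ) := μ.apply_symm_apply _
  simp only [hi0, if_false]
  generalize μ⁻¹ (i : ℤ) = a at *
  rcases lt_or_gt_of_ne ha0 with ha | ha <;> rcases lt_or_gt_of_ne hb0 with hb | hb
  · obtain ⟨a, rfl⟩ : ∃ k : ℕ, a = -(k : ℤ) := ⟨a.natAbs, by omega⟩
    obtain ⟨b, rfl⟩ : ∃ k : ℕ, b = -(k : ℤ) := ⟨b.natAbs, by omega⟩
    rw [abs_le] at han hbn
    rw [hμ.1] at hμa hμb
    obtain rfl := eq_succ_of_map_eq_succ hμinc (a := b) (b := a) (by omega) (by omega)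
      (by omega) (by omega) (by omega)
    rw [hπ.1.1, hπ.1.1, hσ.1.1, hσ.1.1, neg_lt_neg_iff, neg_lt_neg_iff]
    exact map_succ_lt_iff_of_desA_eq hdes (by omega) (by omega)
  · exact iff_of_false ((hπ.map_neg ha han).trans (hπ.map_pos hb hbn)).not_gt
      ((hσ.map_neg ha han).trans (hσ.map_pos hb hbn)).not_gt
  · exact iff_of_true ((hπ.map_neg hb hbn).trans (hπ.map_pos ha han))
      ((hσ.map_neg hb hbn).trans (hσ.map_pos ha han))
  · lift a to ℕ using ha.le
    lift b to ℕ using hb.le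
    rw [abs_le] at han hbn
    obtain rfl := eq_succ_of_map_eq_succ hμinc (a := a) (b := b) (by omega) (by omega)
      (by omega) (by omega) (by omega)
    exact map_succ_lt_iff_of_desA_eq hdes (by omega) (by omega)

end Paper
end
end

section
/- For every integer n≥1, the number of fully commutative signed permutations w∈FC(B_n) with Neg(w)={n} equals exactly n (namely the elements [1,…,j−1,j+1,…,n,−j] for 1≤j≤n). Moreover, for every integer n≥3, the number of w∈FC(B_n) with Neg(w)={1} is at least 2n−2; in particular, for n≥3 the quantity #{w∈FC(B_n) : Neg(w)={i}} is not independent of i∈{1,…,n}. -/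
open scoped Classical

noncomputable section

namespace Paper

/-- The signed permutation `[1, …, j-1, j+1, …, n, -j]`. -/
def negLast (n j : ℤ) (hj : 1 ≤ j) (hjn : j ≤ n) : Equiv.Perm ℤ where
  toFun i := if i = n then -j else if i = -n then j else
    if j ≤ i ∧ i < n then i + 1 else if -n < i ∧ i ≤ -j then i - 1 else i
  invFun v := if v = -j then n else if v = j then -n else
    if j < v ∧ v ≤ n then v - 1 else if -n ≤ v ∧ v < -j then v + 1 else v
  left_inv i := by grind
  right_inv v := by grind

/-- The signed permutation `[-j, 1, …, j-1, j+1, …, n]`. -/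
def negFirst (j : ℤ) (hj : 1 ≤ j) : Equiv.Perm ℤ where
  toFun i := if i = 1 then -j else if i = -1 then j else
    if 2 ≤ i ∧ i ≤ j then i - 1 else if -j ≤ i ∧ i ≤ -2 then i + 1 else i
  invFun v := if v = -j then 1 else if v = j then -1 else
    if 1 ≤ v ∧ v < j then v + 1 else if -j < v ∧ v ≤ -1 then v - 1 else v
  left_inv i := by grind
  right_inv v := by grind

/-- The signed permutation `[-1, 2, …, k-1, k+1, k, k+2, …, n]`. -/
def negOneSwap (k : ℤ) (hk : 2 ≤ k) : Equiv.Perm ℤ where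
  toFun i := if i = 1 then -1 else if i = -1 then 1 else
    if i = k then k + 1 else if i = k + 1 then k else
    if i = -k then -(k + 1) else if i = -(k + 1) then -k else i
  invFun i := if i = 1 then -1 else if i = -1 then 1 else
    if i = k then k + 1 else if i = k + 1 then k else
    if i = -k then -(k + 1) else if i = -(k + 1) then -k else i
  left_inv i := by dsimp only; grind (splits := 20)
  right_inv v := by dsimp only; grind (splits := 20)

theorem InB.abs_le {n : ℕ} {w : Equiv.Perm ℤ} (hw : InB n w) {i : ℤ} (hi : |i| ≤ n) :
    |w i| ≤ n := by
  by_contra! h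
  have := w.injective (hw.2 _ h)
  rw [this] at h
  omega

theorem InB.ext {n : ℕ} {w w' : Equiv.Perm ℤ} (hw : InB n w) (hw' : InB n w')
    (h : ∀ i : ℕ, 1 ≤ i → i ≤ n → w i = w' i) : w = w' := by
  ext i
  have h0 := hw.1 0
  have h0' := hw'.1 0
  rw [neg_zero] at h0 h0'
  by_cases hi : (n : ℤ) < |i|
  · rw [hw.2 i hi, hw'.2 i hi]
  obtain ⟨k, rfl | rfl⟩ := i.eq_nat_or_neg
  · rcases k.eq_zero_or_pos with rfl | hk
    · simp only [Nat.cast_zero]; omega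
    · exact h k hk (by grind)
  · rcases k.eq_zero_or_pos with rfl | hk
    · simp only [Nat.cast_zero, neg_zero]; omega
    · rw [hw.1, hw'.1, h k hk (by grind)]

theorem finite_setOf_inB (n : ℕ) : {w : Equiv.Perm ℤ | InB n w}.Finite := by
  let f : {w : Equiv.Perm ℤ | InB n w} → Set.Icc (1 : ℕ) n → Set.Icc (-n : ℤ) n := fun w i =>
    ⟨w.1 (i.1 : ℤ), abs_le.1 (w.2.abs_le (by rw [Nat.abs_cast]; exact_mod_cast i.2.2))⟩
  refine Set.finite_coe_iff.1 (Finite.of_injective f fun w w' h => ?_)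
  refine Subtype.ext (w.2.ext w'.2 fun i hi hin => ?_)
  exact congrArg Subtype.val (congrFun h ⟨i, hi, hin⟩)

theorem mem_negSet {n : ℕ} {w : Equiv.Perm ℤ} {i : ℕ} :
    i ∈ NegSet n w ↔ (1 ≤ i ∧ i ≤ n) ∧ w (i : ℤ) < 0 := by
  simp [NegSet]

theorem negLast_mem {n : ℕ} {j : ℤ} (hj : 1 ≤ j) (hjn : j ≤ n) :
    IsFC n (negLast n j hj hjn) ∧ NegSet n (negLast n j hj hjn) = {n} := by
  refine ⟨⟨⟨fun i => ?_, fun i hi => ?_⟩, ?_, ?_, ?_⟩, ?_⟩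
  · simp only [negLast, Equiv.coe_fn_mk]; grind
  · simp only [negLast, Equiv.coe_fn_mk]; grind
  · rintro ⟨a, b, h1, h2, h3, h4, h5⟩
    simp only [negLast, Equiv.coe_fn_mk] at h4 h5; grind
  · rintro ⟨a, b, c, h1, h2, h3, h4, h5, h6⟩
    simp only [negLast, Equiv.coe_fn_mk] at h5 h6; grind
  · rintro ⟨a, b, c, h1, h2, h3, h4, h5, h6⟩
    simp only [negLast, Equiv.coe_fn_mk] at h5 h6; grind
  · ext a
    rw [mem_negSet, Finset.mem_singleton]
    simp only [negLast, Equiv.coe_fn_mk]; grind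

theorem negFirst_mem {n : ℕ} {j : ℤ} (hj : 1 ≤ j) (hjn : j ≤ n) :
    IsFC n (negFirst j hj) ∧ NegSet n (negFirst j hj) = {1} := by
  refine ⟨⟨⟨fun i => ?_, fun i hi => ?_⟩, ?_, ?_, ?_⟩, ?_⟩
  · simp only [negFirst, Equiv.coe_fn_mk]; grind
  · simp only [negFirst, Equiv.coe_fn_mk]; grind
  · rintro ⟨a, b, h1, h2, h3, h4, h5⟩
    simp only [negFirst, Equiv.coe_fn_mk] at h4 h5; grind
  · rintro ⟨a, b, c, h1, h2, h3, h4, h5, h6⟩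
    simp only [negFirst, Equiv.coe_fn_mk] at h5 h6; grind
  · rintro ⟨a, b, c, h1, h2, h3, h4, h5, h6⟩
    simp only [negFirst, Equiv.coe_fn_mk] at h5 h6; grind
  · ext a
    rw [mem_negSet, Finset.mem_singleton]
    simp only [negFirst, Equiv.coe_fn_mk]; grind

theorem negOneSwap_mem {n : ℕ} {k : ℤ} (hk : 2 ≤ k) (hkn : k < n) :
    IsFC n (negOneSwap k hk) ∧ NegSet n (negOneSwap k hk) = {1} := by
  refine ⟨⟨⟨fun i => ?_, fun i hi => ?_⟩, ?_, ?_, ?_⟩, ?_⟩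
  · simp only [negOneSwap, Equiv.coe_fn_mk]; grind (splits := 20)
  · simp only [negOneSwap, Equiv.coe_fn_mk]; grind (splits := 20)
  · rintro ⟨a, b, h1, h2, h3, h4, h5⟩
    simp only [negOneSwap, Equiv.coe_fn_mk] at h4 h5; grind (splits := 20)
  · rintro ⟨a, b, c, h1, h2, h3, h4, h5, h6⟩
    simp only [negOneSwap, Equiv.coe_fn_mk] at h5 h6; grind (splits := 20)
  · rintro ⟨a, b, c, h1, h2, h3, h4, h5, h6⟩
    simp only [negOneSwap, Equiv.coe_fn_mk] at h5 h6; grind (splits := 20)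
  · ext a
    rw [mem_negSet, Finset.mem_singleton]
    simp only [negOneSwap, Equiv.coe_fn_mk]; grind (splits := 20)

/-- A fully commutative `w` with `Neg(w) = {n}` is increasing and positive on its first `n - 1`
positions, hence determined by `w_n`. -/
theorem exists_eq_negLast {n : ℕ} (hn : 1 ≤ n) {w : Equiv.Perm ℤ} (hw : IsFC n w)
    (hneg : NegSet n w = {n}) :
    ∃ (j : ℤ) (hj : 1 ≤ j) (hjn : j ≤ n), w = negLast n j hj hjn := by
  obtain ⟨hB, -, hinc, -⟩ := hw
  have hlast : w n < 0 := (mem_negSet.1 (hneg ▸ Finset.mem_singleton_self n)).2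
  have hbound := fun i : ℕ => hB.abs_le (i := i)
  have hne0 : ∀ i : ℕ, 1 ≤ i → w i ≠ 0 := fun i hi h => by
    have h0 := hB.1 0
    rw [neg_zero] at h0
    have := w.injective (h.trans (show 0 = w 0 by omega))
    omega
  have hpos : ∀ i : ℕ, 1 ≤ i → i < n → 0 < w i := fun i hi hin => by
    have hnot : i ∉ NegSet n w := by rw [hneg, Finset.mem_singleton]; omega
    have := hne0 i hi
    rw [mem_negSet] at hnot
    omega
  have hmono : ∀ i j : ℕ, 1 ≤ i → i < j → j < n → w i < w j := fun i j hi hij hjn => by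
    by_contra! h
    have hne : w i ≠ w j := fun h => by have := w.injective h; omega
    have h1 := hpos i hi (by omega)
    have h2 := hpos j (by omega) hjn
    exact hinc ⟨i, j, n, hi, hij, hjn, le_rfl, by rw [abs_of_pos h1]; omega, by omega⟩
  have hgap : ∀ i j : ℕ, 1 ≤ i → i ≤ j → j < n → (j : ℤ) - i ≤ w j - w i := by
    intro i j hi hij
    induction j, hij using Nat.le_induction with
    | base => intro _; omega
    | succ j hij ih =>
      intro hj
      have := ih (by omega)
      have := hmono j (j + 1) (by omega) (by omega) hj
      omega
  have hmem : ∀ i : ℕ, 1 ≤ i → i < n → w i = i ∨ w i = i + 1 := fun i hi hin => by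
    have h1 := hgap 1 i le_rfl hi hin
    have h2 := hpos 1 le_rfl (by omega)
    have h3 := hgap i (n - 1) hi (by omega) (by omega)
    have h4 := abs_le.1 (hbound (n - 1) (by rw [Nat.abs_cast]; omega))
    push_cast [hn] at *
    omega
  have havoid : ∀ i : ℕ, 1 ≤ i → w i ≠ -w n := fun i hi h => by
    rw [← hB.1] at h
    have := w.injective h
    omega
  have hjn : -w n ≤ n := by
    have := abs_le.1 (hbound n (by simp))
    omega
  refine ⟨-w n, by omega, hjn, hB.ext (negLast_mem (by omega) hjn).1.1 fun i hi hin => ?_⟩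
  obtain ⟨m, hm⟩ : ∃ m : ℕ, -w n = m := ⟨(-w n).toNat, by omega⟩
  simp only [negLast, Equiv.coe_fn_mk]
  rcases hin.eq_or_lt with rfl | hin
  · simp
  have hi' := hmem i hi hin
  by_cases him : m ≤ i
  · have h1 := hmem m (by omega) (by omega)
    have h2 := havoid m (by omega)
    have h3 := hgap m i (by omega) him hin
    grind
  · have h1 := hmem (m - 1) (by omega) (by omega)
    have h2 := havoid (m - 1) (by omega)
    have h3 := hgap i (m - 1) hi (by omega) (by omega)
    have h4 : ((m - 1 : ℕ) : ℤ) = m - 1 := by omega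
    grind

theorem card_negSet_eq_last {n : ℕ} (hn : 1 ≤ n) :
    Nat.card {w : Equiv.Perm ℤ // IsFC n w ∧ NegSet n w = {n}} = n := by
  let f : Set.Icc (1 : ℤ) n → {w : Equiv.Perm ℤ // IsFC n w ∧ NegSet n w = {n}} :=
    fun j => ⟨negLast n j j.2.1 j.2.2, negLast_mem j.2.1 j.2.2⟩
  have hf : Function.Bijective f := by
    constructor
    · intro j j' h
      have := congrArg (fun w => w.1 (n : ℤ)) h
      simp only [f, negLast, Equiv.coe_fn_mk, if_true, neg_inj] at this
      exact Subtype.ext this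
    · rintro ⟨w, hw, hneg⟩
      obtain ⟨j, hj, hjn, rfl⟩ := exists_eq_negLast hn hw hneg
      exact ⟨⟨j, hj, hjn⟩, rfl⟩
  rw [← Nat.card_eq_of_bijective f hf]
  simp

theorem le_card_negSet_eq_one {n : ℕ} (hn : 2 ≤ n) :
    2 * n - 2 ≤ Nat.card {w : Equiv.Perm ℤ // IsFC n w ∧ NegSet n w = {1}} := by
  have : Finite {w : Equiv.Perm ℤ // IsFC n w ∧ NegSet n w = {1}} :=
    ((finite_setOf_inB n).subset fun w hw => hw.1.1).to_subtype
  let f : Set.Icc (1 : ℤ) n ⊕ Set.Ico (2 : ℤ) n →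
      {w : Equiv.Perm ℤ // IsFC n w ∧ NegSet n w = {1}} :=
    Sum.elim (fun j => ⟨negFirst j j.2.1, negFirst_mem j.2.1 j.2.2⟩)
      (fun k => ⟨negOneSwap k k.2.1, negOneSwap_mem k.2.1 k.2.2⟩)
  have hf : Function.Injective f := by
    refine Function.Injective.sumElim (fun j j' h => ?_) (fun k k' h => ?_) fun j k h => ?_
    · have := DFunLike.congr_fun (congrArg Subtype.val h) 1
      simp only [negFirst, Equiv.coe_fn_mk] at this
      grind
    · have := DFunLike.congr_fun (congrArg Subtype.val h) k.1
      have := k.2.1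
      simp only [negOneSwap, Equiv.coe_fn_mk] at *
      grind
    · have h1 := DFunLike.congr_fun (congrArg Subtype.val h) 1
      have h2 := DFunLike.congr_fun (congrArg Subtype.val h) k.1
      have := k.2.1
      simp only [negFirst, negOneSwap, Equiv.coe_fn_mk] at *
      grind
  refine le_trans ?_ (Nat.card_le_card_of_injective f hf)
  rw [Nat.card_sum]
  simp
  omega

theorem neg_singleton_counts (n : ℕ) (hn : 1 ≤ n) :
    Nat.card {w : Equiv.Perm ℤ // IsFC n w ∧ NegSet n w = {n}} = n ∧
    (3 ≤ n → 2 * n - 2 ≤ Nat.card {w : Equiv.Perm ℤ // IsFC n w ∧ NegSet n w = {1}}) ∧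
    (3 ≤ n → ∃ i ∈ Finset.Icc 1 n, ∃ j ∈ Finset.Icc 1 n,
      Nat.card {w : Equiv.Perm ℤ // IsFC n w ∧ NegSet n w = {i}} ≠
        Nat.card {w : Equiv.Perm ℤ // IsFC n w ∧ NegSet n w = {j}}) := by
  refine ⟨card_negSet_eq_last hn, fun h => le_card_negSet_eq_one (by omega), fun h =>
    ⟨n, by simp [hn], 1, by simp [hn], ?_⟩⟩
  have := le_card_negSet_eq_one (n := n) (by omega)
  rw [card_negSet_eq_last hn]
  omega

end Paper
end
end
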